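/- Under the fully Bayesian model with σ² ~ InverseGamma(a₀, b₀), the marginal joint posterior satisfies π(γ, D | Y, X) ∝ π(γ|D) π(D) · [z_D(U + XᵀX, n + α(D)) / z_D(U, α(D))] · det(I_{|γ|} + τ² X_γᵀ X_γ)^{−1/2} · {b₀ + ½ Yᵀ (I_n + τ² X_γ X_γᵀ)⁻¹ Y}^{−(n+2a₀)/2}. -/

import Mathlib

open Matrix Real MeasureTheory Finset

noncomputable section

/-- Unit lower triangular Cholesky factor built from a parent structure and free entries. -/
def cholFactor {p : ℕ} (pa : Fin p → Finset (Fin p))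
    (l : ∀ i : Fin p, {j // j ∈ pa i} → ℝ) : Matrix (Fin p) (Fin p) ℝ :=
  fun j i => if j = i then 1 else if h : j ∈ pa i then l i ⟨j, h⟩ else 0

def subGT {p : ℕ} (pa : Fin p → Finset (Fin p))
    (U : Matrix (Fin p) (Fin p) ℝ) (i : Fin p) :
    Matrix {j // j ∈ pa i} {j // j ∈ pa i} ℝ :=
  Matrix.of fun a b => U a.1 b.1

def subGE {p : ℕ} (pa : Fin p → Finset (Fin p))
    (U : Matrix (Fin p) (Fin p) ℝ) (i : Fin p) :
    Matrix (Unit ⊕ {j // j ∈ pa i}) (Unit ⊕ {j // j ∈ pa i}) ℝ :=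
  Matrix.fromBlocks (Matrix.of fun _ _ => U i i) (Matrix.of fun _ b => U i b.1)
    (Matrix.of fun a _ => U a.1 i) (subGT pa U i)

/-- The DAG-Wishart normalizing constant `z_D(U, α)`. -/
def zDAG {p : ℕ} (pa : Fin p → Finset (Fin p))
    (U : Matrix (Fin p) (Fin p) ℝ) (α : Fin p → ℝ) : ℝ :=
  ∏ i : Fin p,
    Real.Gamma (α i / 2 - ((pa i).card : ℝ) / 2 - 1)
      * (2 : ℝ) ^ (α i / 2 - 1)
      * Real.sqrt π ^ ((pa i).card)
      * (subGT pa U i).det ^ (α i / 2 - ((pa i).card : ℝ) / 2 - 3 / 2)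
      / (subGE pa U i).det ^ (α i / 2 - ((pa i).card : ℝ) / 2 - 1)

/-- The normalized DAG-Wishart prior density at `(diagonal d, cholFactor pa l)`. -/
def dagWishartDensity {p : ℕ} (pa : Fin p → Finset (Fin p))
    (U : Matrix (Fin p) (Fin p) ℝ) (α : Fin p → ℝ)
    (d : Fin p → ℝ) (l : ∀ i : Fin p, {j // j ∈ pa i} → ℝ) : ℝ :=
  (zDAG pa U α)⁻¹
    * Real.exp (-(1 / 2) * Matrix.trace
        ((cholFactor pa l * (Matrix.diagonal d)⁻¹ * (cholFactor pa l).transpose) * U))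
    * (∏ i : Fin p, (d i) ^ (-(α i) / 2))
    * (if ∀ i, 0 < d i then 1 else 0)

/-- The Gaussian density of `N_p(0, Ω⁻¹)` (precision matrix `Ω`) at `x`. -/
def gaussDensity {p : ℕ} (Ω : Matrix (Fin p) (Fin p) ℝ) (x : Fin p → ℝ) : ℝ :=
  (2 * π) ^ (-(p : ℝ) / 2) * Ω.det ^ ((1 : ℝ) / 2)
    * Real.exp (-(1 / 2) * (x ⬝ᵥ (Ω *ᵥ x)))

/-- The design matrix restricted to the active columns of `γ`. -/
def designSub {n p : ℕ} (X : Matrix (Fin n) (Fin p) ℝ) (γ : Fin p → Bool) :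
    Matrix (Fin n) {i // γ i = true} ℝ :=
  X.submatrix id (fun a => a.1)

/-- The adjacency matrix `G` of the DAG described by the parent structure `pa`. -/
def adjMat {p : ℕ} (pa : Fin p → Finset (Fin p)) : Matrix (Fin p) (Fin p) ℝ :=
  fun i j => if i ∈ pa j ∨ j ∈ pa i then 1 else 0

/-- The Erdos–Renyi prior `π(𝒟) ∝ ∏_j q^{ν_j} (1-q)^{(p-j)-ν_j} 1{max ν_j < R}`. -/
def dagPrior {p : ℕ} (q : ℝ) (R : ℕ) (pa : Fin p → Finset (Fin p)) : ℝ :=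
  (∏ j : Fin p, q ^ ((pa j).card)
      * (1 - q) ^ ((Finset.univ.filter (fun i : Fin p => j < i)).card - (pa j).card))
    * (if ∀ j : Fin p, (pa j).card < R then 1 else 0)

/-- The unnormalized MRF prior weight `exp(−a 1ᵀγ + b γᵀ G γ) 1{|γ| < R}`. -/
def mrfWeight {p : ℕ} (a b : ℝ) (R : ℕ) (pa : Fin p → Finset (Fin p))
    (γ : Fin p → Bool) : ℝ :=
  Real.exp (-a * ((Finset.univ.filter (fun i => γ i = true)).card : ℝ)
      + b * ((fun i => if γ i then (1 : ℝ) else 0)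
          ⬝ᵥ (adjMat pa *ᵥ fun i => if γ i then (1 : ℝ) else 0)))
    * (if (Finset.univ.filter (fun i => γ i = true)).card < R then 1 else 0)

/-- The normalized MRF prior `π(γ | 𝒟)`. -/
def mrfPrior {p : ℕ} (a b : ℝ) (R : ℕ) (pa : Fin p → Finset (Fin p))
    (γ : Fin p → Bool) : ℝ :=
  mrfWeight a b R pa γ / ∑ γ' : Fin p → Bool, mrfWeight a b R pa γ'

lemma std_gauss {ι : Type*} [Fintype ι] (t : ℝ) :
    ∫ x : ι → ℝ, Real.exp (-t * (x ⬝ᵥ x)) = √(π / t) ^ (Fintype.card ι) := by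
  rw [← integral_gaussian, ← integral_fintype_prod_volume_eq_pow (fun x : ℝ => Real.exp (-t * x ^ 2))]
  congr 1; ext x
  rw [← Real.exp_sum, dotProduct, Finset.mul_sum]
  simp [pow_two]

lemma gauss0 {ι : Type*} [Fintype ι] [DecidableEq ι] (A : Matrix ι ι ℝ) (hA : A.PosDef) (t : ℝ) :
    ∫ x : ι → ℝ, Real.exp (-t * (x ⬝ᵥ (A *ᵥ x))) =
      √(π / t) ^ (Fintype.card ι) * A.det ^ (-(1:ℝ) / 2) := by
  obtain ⟨B, rfl⟩ : ∃ B : Matrix ι ι ℝ, A = Bᴴ * B := by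
    open scoped MatrixOrder in
    exact CStarAlgebra.nonneg_iff_eq_star_mul_self.mp hA.posSemidef.nonneg
  have hd := hA.det_pos
  have hB : B.det ≠ 0 := by
    intro h; simp [h] at hd
  have h1 : ∀ x : ι → ℝ, x ⬝ᵥ ((Bᴴ * B) *ᵥ x) = (toLin' B x) ⬝ᵥ (toLin' B x) := by
    intro x
    rw [← mulVec_mulVec, dotProduct_mulVec, conjTranspose_eq_transpose_of_trivial, vecMul_transpose,
      toLin'_apply]
  simp_rw [h1]
  have hme : MeasurableEmbedding (toLin' B) := by
    have : Function.Injective (toLin' B) := by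
      rw [toLin'_apply']
      exact Matrix.mulVec_injective_iff_isUnit.mpr ((Matrix.isUnit_iff_isUnit_det _).mpr hB.isUnit)
    exact (LinearMap.continuous_of_finiteDimensional _).measurableEmbedding this
  rw [← hme.integral_map (g := fun y => Real.exp (-t * (y ⬝ᵥ y))),
    Real.map_matrix_volume_pi_eq_smul_volume_pi hB, integral_smul_measure, std_gauss,
    ENNReal.toReal_ofReal (abs_nonneg _), smul_eq_mul, mul_comm]
  congr 1
  rw [det_mul, conjTranspose_eq_transpose_of_trivial, det_transpose, ← abs_mul_abs_self,
    ← pow_two, ← Real.rpow_natCast, ← Real.rpow_mul (abs_nonneg _), abs_inv]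
  norm_num [Real.rpow_neg_one]

lemma gauss1 {ι : Type*} [Fintype ι] [DecidableEq ι] (A : Matrix ι ι ℝ) (hA : A.PosDef) (t c : ℝ)
    (v : ι → ℝ) :
    ∫ x : ι → ℝ, Real.exp (-t * (c + 2 * (v ⬝ᵥ x) + x ⬝ᵥ (A *ᵥ x))) =
      Real.exp (-t * (c - v ⬝ᵥ (A⁻¹ *ᵥ v))) * (√(π / t) ^ (Fintype.card ι) * A.det ^ (-(1:ℝ) / 2)) := by
  rw [← gauss0 A hA, ← integral_const_mul,
    ← integral_add_right_eq_self (fun x : ι → ℝ => Real.exp (-t * (c - v ⬝ᵥ (A⁻¹ *ᵥ v))) * Real.exp (-t * (x ⬝ᵥ (A *ᵥ x)))) (A⁻¹ *ᵥ v)]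
  congr 1; ext x
  rw [← Real.exp_add]
  congr 1
  have hu : IsUnit A.det := hA.det_pos.ne'.isUnit
  have h1 : A *ᵥ (A⁻¹ *ᵥ v) = v := by
    rw [mulVec_mulVec, mul_nonsing_inv _ hu, one_mulVec]
  have hs : Aᵀ = A := by
    have := hA.isHermitian
    rwa [IsHermitian, conjTranspose_eq_transpose_of_trivial] at this
  have h2 : (A⁻¹ *ᵥ v) ⬝ᵥ (A *ᵥ x) = v ⬝ᵥ x := by
    rw [dotProduct_mulVec, ← mulVec_transpose, hs, h1]
  rw [mulVec_add, h1, add_dotProduct, dotProduct_add, dotProduct_add, h2, dotProduct_comm x v,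
    dotProduct_comm (A⁻¹ *ᵥ v) v]
  ring

lemma ig_integral (k c : ℝ) (hk : 0 < k) (hc : 0 < c) :
    ∫ s in Set.Ioi (0:ℝ), s ^ (-k - 1) * Real.exp (-c / s) = Real.Gamma k * c ^ (-k) := by
  have h := integral_comp_rpow_Ioi (fun y : ℝ => y ^ (k - 1) * Real.exp (-(c * y)))
    (p := -1) (by norm_num)
  rw [Real.integral_rpow_mul_exp_neg_mul_Ioi hk hc] at h
  rw [Real.rpow_neg hc.le, mul_comm, ← Real.inv_rpow hc.le, ← one_div, ← h]
  refine setIntegral_congr_fun measurableSet_Ioi fun s hs => ?_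
  have hs : 0 < s := hs
  simp only [smul_eq_mul]
  rw [← Real.rpow_mul hs.le, ← mul_assoc, abs_neg, abs_one, one_mul, ← Real.rpow_add hs,
    Real.rpow_neg_one]
  congr 2
  · ring
  · rw [neg_div, div_eq_mul_inv]

lemma ig_integrable (k c : ℝ) (hk : 0 < k) (hc : 0 < c) :
    IntegrableOn (fun s : ℝ => s ^ (-k - 1) * Real.exp (-c / s)) (Set.Ioi (0:ℝ)) := by
  refine Integrable.of_integral_ne_zero ?_
  rw [ig_integral k c hk hc]
  have := Real.Gamma_pos_of_pos hk
  positivity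

lemma quad_int {ι : Type*} [Fintype ι] [DecidableEq ι] (A : Matrix ι ι ℝ) (hA : A.PosDef)
    (c k : ℝ) (v : ι → ℝ) (hS : 0 < c - v ⬝ᵥ (A⁻¹ *ᵥ v)) (hk : 0 < k - (Fintype.card ι : ℝ) / 2) :
    ∫ x : ι → ℝ, ∫ d in Set.Ioi (0:ℝ),
        d ^ (-k - 1) * Real.exp (-(1 / 2) * ((c + 2 * (v ⬝ᵥ x) + x ⬝ᵥ (A *ᵥ x)) / d)) =
      Real.Gamma (k - (Fintype.card ι : ℝ) / 2) * 2 ^ k * √π ^ (Fintype.card ι)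
        * A.det ^ (-(1:ℝ) / 2) * (c - v ⬝ᵥ (A⁻¹ *ᵥ v)) ^ (-(k - (Fintype.card ι : ℝ) / 2)) := by
  set S := c - v ⬝ᵥ (A⁻¹ *ᵥ v) with hSdef
  set k' := k - (Fintype.card ι : ℝ) / 2 with hk'
  have hdet := hA.det_pos
  have key : ∀ d : ℝ, 0 < d → ∫ x : ι → ℝ,
      d ^ (-k - 1) * Real.exp (-(1 / 2) * ((c + 2 * (v ⬝ᵥ x) + x ⬝ᵥ (A *ᵥ x)) / d)) =
      (√(2 * π) ^ (Fintype.card ι) * A.det ^ (-(1:ℝ) / 2)) *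
        (d ^ (-k' - 1) * Real.exp (-(S / 2) / d)) := by
    intro d hd
    have h1 : ∀ x : ι → ℝ, -(1 / 2) * ((c + 2 * (v ⬝ᵥ x) + x ⬝ᵥ (A *ᵥ x)) / d)
        = -(1 / (2 * d)) * (c + 2 * (v ⬝ᵥ x) + x ⬝ᵥ (A *ᵥ x)) := by
      intro x; field_simp
    simp_rw [h1]
    rw [integral_const_mul, gauss1 A hA]
    have h2 : π / (1 / (2 * d)) = (2 * π) * d := by field_simp
    have h3 : d ^ (-k' - 1) = d ^ (-k - 1) * √d ^ (Fintype.card ι) := by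
      rw [Real.sqrt_eq_rpow, ← Real.rpow_natCast, ← Real.rpow_mul hd.le, ← Real.rpow_add hd]
      congr 1; rw [hk']; ring
    have h4 : -(1 / (2 * d)) * (c - v ⬝ᵥ (A⁻¹ *ᵥ v)) = -(S / 2) / d := by
      rw [hSdef]; field_simp
    rw [h2, h3, h4, Real.sqrt_mul (by positivity), mul_pow]
    ring
  have hmeas : AEStronglyMeasurable (fun z : (ι → ℝ) × ℝ =>
      z.2 ^ (-k - 1) * Real.exp (-(1 / 2) * ((c + 2 * (v ⬝ᵥ z.1) + z.1 ⬝ᵥ (A *ᵥ z.1)) / z.2)))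
      ((volume : Measure (ι → ℝ)).prod (volume.restrict (Set.Ioi (0:ℝ)))) := by
    apply Measurable.aestronglyMeasurable
    have hq : Measurable (fun x : ι → ℝ => c + 2 * (v ⬝ᵥ x) + x ⬝ᵥ (A *ᵥ x)) := by
      apply Continuous.measurable
      fun_prop
    have : Measurable (fun z : (ι → ℝ) × ℝ => c + 2 * (v ⬝ᵥ z.1) + z.1 ⬝ᵥ (A *ᵥ z.1)) :=
      hq.comp measurable_fst
    fun_prop
  have hint : Integrable (fun z : (ι → ℝ) × ℝ =>
      z.2 ^ (-k - 1) * Real.exp (-(1 / 2) * ((c + 2 * (v ⬝ᵥ z.1) + z.1 ⬝ᵥ (A *ᵥ z.1)) / z.2)))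
      ((volume : Measure (ι → ℝ)).prod (volume.restrict (Set.Ioi (0:ℝ)))) := by
    rw [integrable_prod_iff' hmeas]
    constructor
    · refine (ae_restrict_iff' measurableSet_Ioi).mpr (ae_of_all _ fun d hd => ?_)
      have hd : 0 < d := hd
      refine Integrable.of_integral_ne_zero ?_
      rw [key d hd]
      positivity
    · have := (ig_integrable k' (S / 2) hk (by positivity)).const_mul
        (√(2 * π) ^ (Fintype.card ι) * A.det ^ (-(1:ℝ) / 2))
      refine (integrable_congr ?_).mpr this
      refine (ae_restrict_iff' measurableSet_Ioi).mpr (ae_of_all _ fun d hd => ?_)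
      have hd : 0 < d := hd
      simp only
      rw [← key d hd]
      congr 1; ext x
      rw [Real.norm_of_nonneg (by positivity)]
  rw [integral_integral_swap hint, setIntegral_congr_fun measurableSet_Ioi (fun d hd => key d hd),
    integral_const_mul, ig_integral k' _ hk (by positivity)]
  rw [Real.div_rpow hS.le (by norm_num), Real.sqrt_mul (by norm_num), mul_pow]
  have h5 : (2:ℝ) ^ k = √2 ^ (Fintype.card ι) / 2 ^ (-k') := by
    rw [Real.sqrt_eq_rpow, ← Real.rpow_natCast, ← Real.rpow_mul (by norm_num),
      ← Real.rpow_sub (by norm_num)]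
    congr 1; rw [hk']; ring
  rw [h5]
  ring

lemma quad_gamma {ι κ : Type*} [Fintype ι] [DecidableEq ι] [Fintype κ] [DecidableEq κ]
    (X : Matrix κ ι ℝ) (Y : κ → ℝ) (τ a₀ b₀ : ℝ) (hτ : 0 < τ) (ha₀ : 0 < a₀) (hb₀ : 0 < b₀) :
    (∫ s in Set.Ioi (0 : ℝ),
        (b₀ ^ a₀ / Real.Gamma a₀ * s ^ (-a₀ - 1) * Real.exp (-b₀ / s))
          * ∫ β : ι → ℝ,
              ((2 * π * s) ^ (-(Fintype.card κ : ℝ) / 2)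
                  * Real.exp (-((Y - X *ᵥ β) ⬝ᵥ (Y - X *ᵥ β)) / (2 * s)))
                * ((2 * π * τ ^ 2 * s) ^ (-(Fintype.card ι : ℝ) / 2)
                  * Real.exp (-(β ⬝ᵥ β) / (2 * τ ^ 2 * s))))
     = (b₀ ^ a₀ / Real.Gamma a₀ * (2 * π) ^ (-(Fintype.card κ : ℝ) / 2)
          * Real.Gamma (a₀ + (Fintype.card κ : ℝ) / 2))
        * (Matrix.det (1 + (τ ^ 2) • (Xᵀ * X)) ^ (-(1 : ℝ) / 2)
              * (b₀ + (1 / 2) * (Y ⬝ᵥ ((1 + (τ ^ 2) • (X * Xᵀ))⁻¹ *ᵥ Y)))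
                  ^ (-((Fintype.card κ : ℝ) + 2 * a₀) / 2)) := by
  set N : ℝ := (Fintype.card κ : ℝ)
  set B : Matrix ι ι ℝ := 1 + (τ ^ 2) • (Xᵀ * X) with hB
  set W : Matrix κ κ ℝ := 1 + (τ ^ 2) • (X * Xᵀ) with hW
  have hBpd : B.PosDef := by
    refine PosDef.one.add_posSemidef (PosSemidef.smul ?_ (by positivity))
    simpa using posSemidef_conjTranspose_mul_self X
  have hWpd : W.PosDef := by
    refine PosDef.one.add_posSemidef (PosSemidef.smul ?_ (by positivity))
    simpa using posSemidef_self_mul_conjTranspose X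
  set A : Matrix ι ι ℝ := (τ ^ 2)⁻¹ • B with hAdef
  have hApd : A.PosDef := hBpd.smul (by positivity)
  have hWinv : W⁻¹ = 1 - X * A⁻¹ * Xᵀ := by
    apply Matrix.inv_eq_right_inv
    have hAA : A * A⁻¹ = 1 := mul_nonsing_inv _ hApd.det_pos.ne'.isUnit
    have hWX : W * X = (τ ^ 2) • (X * A) := by
      rw [hW, hAdef, hB]
      simp only [Matrix.add_mul, Matrix.mul_add, Matrix.one_mul, Matrix.mul_smul, Matrix.smul_mul,
        Matrix.mul_one, smul_smul, smul_add, Matrix.mul_assoc]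
      rw [mul_inv_cancel₀ (by positivity), one_smul, inv_mul_cancel₀ (by positivity), mul_one]
    rw [Matrix.mul_sub, Matrix.mul_one, ← Matrix.mul_assoc, ← Matrix.mul_assoc, hWX]
    simp only [Matrix.smul_mul, Matrix.mul_assoc]
    rw [← Matrix.mul_assoc A, hAA, Matrix.one_mul, hW]
    simp
  set q := Y ⬝ᵥ (W⁻¹ *ᵥ Y) with hq
  have hqnn : 0 ≤ q := by
    have := hWpd.inv.posSemidef.dotProduct_mulVec_nonneg Y
    simpa using this
  have hYq : Y ⬝ᵥ Y - (-(Xᵀ *ᵥ Y)) ⬝ᵥ (A⁻¹ *ᵥ (-(Xᵀ *ᵥ Y))) = q := by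
    rw [hq, hWinv, sub_mulVec, dotProduct_sub, one_mulVec, mulVec_neg, neg_dotProduct_neg,
      ← mulVec_mulVec, ← mulVec_mulVec, dotProduct_mulVec Y X, ← mulVec_transpose]
  have hdetA : A.det ^ (-(1:ℝ)/2) = (τ ^ 2) ^ ((Fintype.card ι : ℝ) / 2) * B.det ^ (-(1:ℝ)/2) := by
    rw [hAdef, det_smul, Real.mul_rpow (by positivity) hBpd.det_pos.le, ← Real.rpow_natCast,
      ← Real.rpow_mul (by positivity), Real.inv_rpow (by positivity), ← Real.rpow_neg (by positivity)]
    congr 2; ring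
  have key : ∀ s : ℝ, 0 < s → 
      (b₀ ^ a₀ / Real.Gamma a₀ * s ^ (-a₀ - 1) * Real.exp (-b₀ / s))
          * ∫ β : ι → ℝ,
              ((2 * π * s) ^ (-N / 2)
                  * Real.exp (-((Y - X *ᵥ β) ⬝ᵥ (Y - X *ᵥ β)) / (2 * s)))
                * ((2 * π * τ ^ 2 * s) ^ (-(Fintype.card ι : ℝ) / 2)
                  * Real.exp (-(β ⬝ᵥ β) / (2 * τ ^ 2 * s)))
      = (b₀ ^ a₀ / Real.Gamma a₀ * (2 * π) ^ (-N / 2) * B.det ^ (-(1:ℝ)/2))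
        * (s ^ (-(a₀ + N / 2) - 1) * Real.exp (-(b₀ + 1 / 2 * q) / s)) := by
    intro s hs
    have h1 : ∀ β : ι → ℝ, ((2 * π * s) ^ (-N / 2)
                  * Real.exp (-((Y - X *ᵥ β) ⬝ᵥ (Y - X *ᵥ β)) / (2 * s)))
                * ((2 * π * τ ^ 2 * s) ^ (-(Fintype.card ι : ℝ) / 2)
                  * Real.exp (-(β ⬝ᵥ β) / (2 * τ ^ 2 * s)))
        = ((2 * π * s) ^ (-N / 2) * (2 * π * τ ^ 2 * s) ^ (-(Fintype.card ι : ℝ) / 2))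
          * Real.exp (-(1 / (2 * s)) *
            (Y ⬝ᵥ Y + 2 * ((-(Xᵀ *ᵥ Y)) ⬝ᵥ β) + β ⬝ᵥ (A *ᵥ β))) := by
      intro β
      rw [mul_mul_mul_comm, ← Real.exp_add]
      congr 2
      have e1 : (X *ᵥ β) ⬝ᵥ (X *ᵥ β) = β ⬝ᵥ ((Xᵀ * X) *ᵥ β) := by
        rw [← mulVec_mulVec, dotProduct_mulVec β, vecMul_transpose]
      have e2 : β ⬝ᵥ (A *ᵥ β) = (τ ^ 2)⁻¹ * (β ⬝ᵥ β) + (X *ᵥ β) ⬝ᵥ (X *ᵥ β) := by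
        rw [e1, hAdef, hB, smul_mulVec, add_mulVec, smul_mulVec, one_mulVec, dotProduct_smul,
          dotProduct_add, dotProduct_smul, smul_eq_mul, smul_eq_mul]
        field_simp
      have e3 : (-(Xᵀ *ᵥ Y)) ⬝ᵥ β = - (Y ⬝ᵥ (X *ᵥ β)) := by
        rw [neg_dotProduct, mulVec_transpose, dotProduct_mulVec]
      rw [e2, e3, sub_dotProduct, dotProduct_sub, dotProduct_sub, dotProduct_comm (X *ᵥ β) Y]
      field_simp
      ring
    simp_rw [h1]
    rw [integral_const_mul, gauss1 A hApd, hYq, hdetA]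
    have h2 : π / (1 / (2 * s)) = 2 * π * s := by field_simp
    have h3 : (2 * π * τ ^ 2 * s) ^ (-(Fintype.card ι : ℝ) / 2)
        * (√(2 * π * s) ^ (Fintype.card ι) * (τ ^ 2) ^ ((Fintype.card ι : ℝ) / 2)) = 1 := by
      rw [Real.sqrt_eq_rpow, ← Real.rpow_mul_natCast (by positivity),
        one_div_mul_eq_div, ← Real.mul_rpow (by positivity) (by positivity),
        show 2 * π * s * τ ^ 2 = 2 * π * τ ^ 2 * s by ring, ← Real.rpow_add (by positivity)]
      rw [neg_div, neg_add_cancel, Real.rpow_zero]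
    have h4 : s ^ (-(a₀ + N / 2) - 1) = s ^ (-a₀ - 1) * s ^ (-N / 2) := by
      rw [← Real.rpow_add hs]; congr 1; ring
    have h5 : Real.exp (-(b₀ + 1 / 2 * q) / s) = Real.exp (-b₀ / s) * Real.exp (-(1 / (2 * s)) * q) := by
      rw [← Real.exp_add]; congr 1; field_simp; ring
    rw [h2, h4, h5, Real.mul_rpow (x := 2 * π) (by positivity) hs.le]
    linear_combination (b₀ ^ a₀ / Real.Gamma a₀ * (2 * π) ^ (-N / 2) * B.det ^ (-(1:ℝ)/2)) *
      (s ^ (-a₀ - 1) * s ^ (-N / 2) * (Real.exp (-b₀ / s) * Real.exp (-(1 / (2 * s)) * q))) * h3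
  rw [setIntegral_congr_fun measurableSet_Ioi (fun s hs => key s hs), integral_const_mul,
    ig_integral _ _ (by positivity) (by positivity),
    show -(N + 2 * a₀) / 2 = -(a₀ + N / 2) by ring]
  ring

lemma sum_chol {p : ℕ} (pa : Fin p → Finset (Fin p)) (i : Fin p) (hi : i ∉ pa i)
    (l : ∀ i : Fin p, {j // j ∈ pa i} → ℝ) (f : Fin p → ℝ) :
    ∑ j, f j * cholFactor pa l j i = f i + ∑ b : {j // j ∈ pa i}, f b.1 * l i b := by
  have h1 : ∀ j, f j * cholFactor pa l j i = (if j = i then f j else 0)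
      + (if h : j ∈ pa i then f j * l i ⟨j, h⟩ else 0) := by
    intro j
    unfold cholFactor
    by_cases hj : j = i
    · subst hj; simp [hi]
    · by_cases h : j ∈ pa i <;> simp [hj, h]
  simp_rw [h1]
  rw [Finset.sum_add_distrib]
  congr 1
  · simp
  · have h2 : ∀ b : {j // j ∈ pa i}, f b.1 * l i b
        = (fun j => if h : j ∈ pa i then f j * l i ⟨j, h⟩ else 0) b.1 := by
      intro b; simp [b.2]
    rw [Finset.sum_congr rfl (fun b _ => h2 b), Finset.sum_coe_sort (pa i)
      (fun j => if h : j ∈ pa i then f j * l i ⟨j, h⟩ else 0)]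
    symm
    apply Finset.sum_subset (Finset.subset_univ _)
    intro j _ hj
    simp [hj]

/-- the quadratic form of the i-th column -/
def colQuad {p : ℕ} (pa : Fin p → Finset (Fin p)) (V : Matrix (Fin p) (Fin p) ℝ) (i : Fin p)
    (x : {j // j ∈ pa i} → ℝ) : ℝ :=
  V i i + 2 * ((fun b : {j // j ∈ pa i} => V i b.1) ⬝ᵥ x) + x ⬝ᵥ (subGT pa V i *ᵥ x)

lemma posDef_symm {ι : Type*} {V : Matrix ι ι ℝ} (hV : V.PosDef) (i j : ι) : V i j = V j i := by
  have := hV.isHermitian.apply i j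
  simpa using this.symm

lemma trace_chol {p : ℕ} (pa : Fin p → Finset (Fin p)) (hpa : ∀ i, i ∉ pa i)
    (l : ∀ i : Fin p, {j // j ∈ pa i} → ℝ) (e : Fin p → ℝ)
    (V : Matrix (Fin p) (Fin p) ℝ) (hV : V.PosDef) :
    Matrix.trace ((cholFactor pa l * Matrix.diagonal e * (cholFactor pa l).transpose) * V)
      = ∑ i, e i * colQuad pa V i (l i) := by
  rw [Matrix.mul_assoc, Matrix.trace_mul_comm, Matrix.trace]
  refine Finset.sum_congr rfl fun i _ => ?_
  rw [Matrix.diag_apply, ← Matrix.mul_assoc, Matrix.mul_diagonal, mul_comm]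
  congr 1
  rw [Matrix.mul_apply]
  rw [sum_chol pa i (hpa i)]
  have h1 : ∀ k, ((cholFactor pa l)ᵀ * V) i k
      = V i k + ∑ b : {j // j ∈ pa i}, V b.1 k * l i b := by
    intro k
    rw [Matrix.mul_apply, ← sum_chol pa i (hpa i) l (fun j => V j k)]
    refine Finset.sum_congr rfl fun j _ => ?_
    rw [Matrix.transpose_apply, mul_comm]
  simp_rw [h1]
  unfold colQuad
  simp only [dotProduct, mulVec, subGT, Matrix.of_apply]
  simp_rw [add_mul]
  rw [Finset.sum_add_distrib]
  have h2 : ∑ b : {j // j ∈ pa i}, V b.1 i * l i b = ∑ b : {j // j ∈ pa i}, V i b.1 * l i b :=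
    Finset.sum_congr rfl fun b _ => by rw [posDef_symm hV]
  have h3 : ∑ x : {j // j ∈ pa i}, (∑ b : {j // j ∈ pa i}, V b.1 x.1 * l i b) * l i x
      = ∑ x : {j // j ∈ pa i}, l i x * ∑ b : {j // j ∈ pa i}, V x.1 b.1 * l i b := by
    refine Finset.sum_congr rfl fun x _ => ?_
    rw [mul_comm]
    congr 1
    exact Finset.sum_congr rfl fun b _ => by rw [posDef_symm hV]
  rw [h2, h3]
  ring

lemma subGT_posDef {p : ℕ} (pa : Fin p → Finset (Fin p)) (i : Fin p)
    (V : Matrix (Fin p) (Fin p) ℝ) (hV : V.PosDef) : (subGT pa V i).PosDef :=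
  hV.submatrix (e := fun a : {j // j ∈ pa i} => a.1) Subtype.val_injective

lemma subGE_posDef {p : ℕ} (pa : Fin p → Finset (Fin p)) (i : Fin p) (hi : i ∉ pa i)
    (V : Matrix (Fin p) (Fin p) ℝ) (hV : V.PosDef) : (subGE pa V i).PosDef := by
  have : subGE pa V i = V.submatrix (Sum.elim (fun _ : Unit => i) (fun a : {j // j ∈ pa i} => a.1))
      (Sum.elim (fun _ : Unit => i) (fun a : {j // j ∈ pa i} => a.1)) := by
    ext a b
    rcases a with a | a <;> rcases b with b | b <;> rfl
  rw [this]
  refine hV.submatrix ?_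
  rintro (a | a) (b | b) h
  · rfl
  · simp only [Sum.elim_inl, Sum.elim_inr] at h
    have hb := b.2
    rw [← h] at hb
    exact absurd hb hi
  · simp only [Sum.elim_inl, Sum.elim_inr] at h
    have ha := a.2
    rw [h] at ha
    exact absurd ha hi
  · simp only [Sum.elim_inr] at h
    rw [Subtype.ext h]

lemma subGE_det {p : ℕ} (pa : Fin p → Finset (Fin p)) (i : Fin p)
    (V : Matrix (Fin p) (Fin p) ℝ) (hV : V.PosDef) :
    (subGE pa V i).det = (subGT pa V i).det * (V i i - (fun b : {j // j ∈ pa i} => V i b.1) ⬝ᵥ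
      ((subGT pa V i)⁻¹ *ᵥ (fun b : {j // j ∈ pa i} => V i b.1))) := by
  have hG := subGT_posDef pa i V hV
  let _ : Invertible (subGT pa V i) := Matrix.invertibleOfIsUnitDet _ hG.det_pos.ne'.isUnit
  rw [subGE, det_fromBlocks₂₂, Matrix.invOf_eq_nonsing_inv]
  congr 1
  rw [Matrix.det_unique, Matrix.sub_apply, Matrix.of_apply, Matrix.mul_assoc, Matrix.mul_apply]
  congr 1
  refine Finset.sum_congr rfl fun b _ => ?_
  rw [Matrix.of_apply, Matrix.mul_apply]
  congr 1
  refine Finset.sum_congr rfl fun c _ => ?_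
  rw [Matrix.of_apply, posDef_symm hV]

lemma factor_int {p : ℕ} (pa : Fin p → Finset (Fin p)) (i : Fin p) (hi : i ∉ pa i)
    (V : Matrix (Fin p) (Fin p) ℝ) (hV : V.PosDef) (α : ℝ) (hα : 2 < α - ((pa i).card : ℝ)) :
    (∫ x : {j // j ∈ pa i} → ℝ, ∫ d : ℝ,
      if 0 < d then d ^ (-α / 2) * Real.exp (-(1 / 2) * (colQuad pa V i x / d)) else 0)
    = Real.Gamma (α / 2 - ((pa i).card : ℝ) / 2 - 1)
      * (2 : ℝ) ^ (α / 2 - 1)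
      * Real.sqrt π ^ ((pa i).card)
      * (subGT pa V i).det ^ (α / 2 - ((pa i).card : ℝ) / 2 - 3 / 2)
      / (subGE pa V i).det ^ (α / 2 - ((pa i).card : ℝ) / 2 - 1) := by
  have hG := subGT_posDef pa i V hV
  have hGd := hG.det_pos
  have hE := (subGE_posDef pa i hi V hV).det_pos
  have hdet := subGE_det pa i V hV
  have hS : 0 < V i i - (fun b : {j // j ∈ pa i} => V i b.1) ⬝ᵥ
      ((subGT pa V i)⁻¹ *ᵥ (fun b : {j // j ∈ pa i} => V i b.1)) := by
    rw [hdet] at hE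
    exact (pos_iff_pos_of_mul_pos hE).mp hGd
  have hcard : Fintype.card {j // j ∈ pa i} = (pa i).card := Fintype.card_coe _
  have hq := quad_int (subGT pa V i) hG (V i i) (α / 2 - 1) (fun b => V i b.1) hS
    (by rw [hcard]; linarith)
  have h1 : ∀ x : {j // j ∈ pa i} → ℝ, (∫ d : ℝ,
      if 0 < d then d ^ (-α / 2) * Real.exp (-(1 / 2) * (colQuad pa V i x / d)) else 0)
      = ∫ d in Set.Ioi (0:ℝ), d ^ (-(α / 2 - 1) - 1) *
        Real.exp (-(1 / 2) * ((V i i + 2 * ((fun b : {j // j ∈ pa i} => V i b.1) ⬝ᵥ x)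
          + x ⬝ᵥ (subGT pa V i *ᵥ x)) / d)) := by
    intro x
    rw [← integral_indicator measurableSet_Ioi]
    congr 1; ext d
    rw [Set.indicator_apply]
    simp only [Set.mem_Ioi, colQuad]
    congr 3
    ring
  simp_rw [h1]
  rw [hq, hcard, hdet, Real.mul_rpow hGd.le hS.le,
    show α / 2 - 1 - ((pa i).card : ℝ) / 2 = α / 2 - ((pa i).card : ℝ) / 2 - 1 by ring,
    show α / 2 - ((pa i).card : ℝ) / 2 - 3 / 2 = (α / 2 - ((pa i).card : ℝ) / 2 - 1) + -1 / 2 by ring,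
    Real.rpow_add hGd, Real.rpow_neg hS.le]
  field_simp

lemma inv_diag {p : ℕ} (d : Fin p → ℝ) (hd : ∀ i, 0 < d i) :
    (Matrix.diagonal d)⁻¹ = Matrix.diagonal (fun i => (d i)⁻¹) := by
  apply Matrix.inv_eq_right_inv
  rw [Matrix.diagonal_mul_diagonal, ← Matrix.diagonal_one]
  congr 1; ext i
  exact mul_inv_cancel₀ (hd i).ne'

lemma zDAG_integral {p : ℕ} (pa : Fin p → Finset (Fin p)) (hpa : ∀ i, i ∉ pa i)
    (V : Matrix (Fin p) (Fin p) ℝ) (hV : V.PosDef) (α : Fin p → ℝ)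
    (hα : ∀ i, 2 < α i - ((pa i).card : ℝ)) :
    (∫ l : ∀ i : Fin p, {j // j ∈ pa i} → ℝ, ∫ d : Fin p → ℝ,
      Real.exp (-(1 / 2) * Matrix.trace
        ((cholFactor pa l * (Matrix.diagonal d)⁻¹ * (cholFactor pa l).transpose) * V))
      * (∏ i : Fin p, (d i) ^ (-(α i) / 2))
      * (if ∀ i, 0 < d i then 1 else 0)) = zDAG pa V α := by
  have h1 : ∀ (l : ∀ i : Fin p, {j // j ∈ pa i} → ℝ) (d : Fin p → ℝ),
      Real.exp (-(1 / 2) * Matrix.trace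
        ((cholFactor pa l * (Matrix.diagonal d)⁻¹ * (cholFactor pa l).transpose) * V))
      * (∏ i : Fin p, (d i) ^ (-(α i) / 2))
      * (if ∀ i, 0 < d i then 1 else 0)
      = ∏ i, (fun (i : Fin p) (d : ℝ) => if 0 < d then d ^ (-(α i) / 2) *
          Real.exp (-(1 / 2) * (colQuad pa V i (l i) / d)) else 0) i (d i) := by
    intro l d
    by_cases hd : ∀ i, 0 < d i
    · rw [if_pos hd, mul_one, inv_diag d hd, trace_chol pa hpa l _ V hV, Finset.mul_sum,
        Real.exp_sum, ← Finset.prod_mul_distrib]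
      refine Finset.prod_congr rfl fun i _ => ?_
      simp only [hd i, if_true]
      rw [mul_comm, div_eq_inv_mul (b := d i)]
    · rw [if_neg hd, mul_zero]
      push Not at hd
      obtain ⟨i, hi⟩ := hd
      symm
      apply Finset.prod_eq_zero (Finset.mem_univ i)
      simp [not_lt.mpr hi]
  simp_rw [h1]
  have h2 : ∀ l : ∀ i : Fin p, {j // j ∈ pa i} → ℝ, (∫ d : Fin p → ℝ,
      ∏ i, (fun (i : Fin p) (d : ℝ) => if 0 < d then d ^ (-(α i) / 2) *
          Real.exp (-(1 / 2) * (colQuad pa V i (l i) / d)) else 0) i (d i))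
      = ∏ i, (fun (i : Fin p) (x : {j // j ∈ pa i} → ℝ) => ∫ d : ℝ, if 0 < d then d ^ (-(α i) / 2) *
          Real.exp (-(1 / 2) * (colQuad pa V i x / d)) else 0) i (l i) := by
    intro l
    exact integral_fintype_prod_volume_eq_prod (fun (i : Fin p) (d : ℝ) =>
      if 0 < d then d ^ (-(α i) / 2) *
          Real.exp (-(1 / 2) * (colQuad pa V i (l i) / d)) else 0)
  refine (integral_congr_ae (ae_of_all _ h2)).trans ?_
  rw [integral_fintype_prod_volume_eq_prod (fun (i : Fin p) (x : {j // j ∈ pa i} → ℝ) =>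
    ∫ d : ℝ, if 0 < d then d ^ (-(α i) / 2) *
          Real.exp (-(1 / 2) * (colQuad pa V i x / d)) else 0)]
  exact Finset.prod_congr rfl fun i _ => factor_int pa i (hpa i) V hV (α i) (hα i)

lemma chol_det {p : ℕ} (pa : Fin p → Finset (Fin p)) (hpa : ∀ i : Fin p, ∀ j ∈ pa i, i < j)
    (l : ∀ i : Fin p, {j // j ∈ pa i} → ℝ) : (cholFactor pa l).det = 1 := by
  rw [Matrix.det_of_isLowerTriangular]
  · simp [cholFactor]
  · intro i j hij
    have hij : i < j := hij
    have h2 : i ∉ pa j := fun h => absurd (hpa j i h) (not_lt.mpr hij.le)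
    simp [cholFactor, hij.ne, h2]

lemma wishart_part {n p : ℕ} (X : Matrix (Fin n) (Fin p) ℝ)
    (U : Matrix (Fin p) (Fin p) ℝ) (hU : U.PosDef) (pa : Fin p → Finset (Fin p))
    (hpa : ∀ i : Fin p, ∀ j ∈ pa i, i < j) (α : Fin p → ℝ)
    (hα : ∀ i, 2 < α i - ((pa i).card : ℝ)) :
    (∫ l : ∀ i : Fin p, {j // j ∈ pa i} → ℝ, ∫ d : Fin p → ℝ,
                dagWishartDensity pa U α d l
                  * ∏ k : Fin n,
                      gaussDensity
                        (cholFactor pa l * (Matrix.diagonal d)⁻¹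
                          * (cholFactor pa l).transpose) (X k))
    = ((2 * π) ^ (-(p : ℝ) / 2)) ^ n *
      (zDAG pa (U + X.transpose * X) (fun i => (n : ℝ) + α i) / zDAG pa U α) := by
  have hV : (U + Xᵀ * X).PosDef := by
    refine hU.add_posSemidef ?_
    simpa using posSemidef_conjTranspose_mul_self X
  have hpa' : ∀ i, i ∉ pa i := fun i h => lt_irrefl _ (hpa i i h)
  rw [← zDAG_integral pa hpa' (U + Xᵀ * X) hV (fun i => (n : ℝ) + α i)
    (fun i => by have := hα i; have : (0:ℝ) ≤ n := n.cast_nonneg; linarith),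
    div_eq_inv_mul (b := zDAG pa U α), ← mul_assoc, ← integral_const_mul]
  congr 1; ext l
  rw [← integral_const_mul]
  congr 1; ext d
  unfold dagWishartDensity
  by_cases hd : ∀ i, 0 < d i
  · simp only [if_pos hd]
    set Ω := cholFactor pa l * (Matrix.diagonal d)⁻¹ * (cholFactor pa l).transpose with hΩ
    have hdet : Ω.det = ∏ i, (d i)⁻¹ := by
      rw [hΩ, det_mul, det_mul, det_transpose, chol_det pa hpa, inv_diag d hd, det_diagonal]
      ring
    have htr : ∑ k : Fin n, X k ⬝ᵥ (Ω *ᵥ X k) = Matrix.trace (Ω * (Xᵀ * X)) := by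
      rw [← Matrix.mul_assoc, Matrix.trace_mul_comm, Matrix.trace]
      refine Finset.sum_congr rfl fun k _ => ?_
      rw [Matrix.diag_apply, Matrix.mul_apply]
      refine Finset.sum_congr rfl fun j _ => ?_
      rw [Matrix.mul_apply]
      rfl
    have hg : ∏ k : Fin n, gaussDensity Ω (X k) = ((2 * π) ^ (-(p : ℝ) / 2)) ^ n
        * (∏ i, (d i) ^ (-(n:ℝ) / 2)) * Real.exp (-(1 / 2) * Matrix.trace (Ω * (Xᵀ * X))) := by
      unfold gaussDensity
      rw [Finset.prod_mul_distrib, ← Real.exp_sum, ← Finset.mul_sum, htr, Finset.prod_const,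
        Finset.card_univ, Fintype.card_fin, mul_pow, hdet, ← Real.rpow_mul_natCast
          (Finset.prod_nonneg fun i _ => (inv_pos.mpr (hd i)).le),
        ← Real.finsetProd_rpow _ _ (fun i _ => (inv_pos.mpr (hd i)).le)]
      congr 2
      refine Finset.prod_congr rfl fun i _ => ?_
      rw [Real.inv_rpow (hd i).le, ← Real.rpow_neg (hd i).le]
      congr 1; ring
    have hp : ∏ i, (d i) ^ (-((n:ℝ) + α i) / 2)
        = (∏ i, (d i) ^ (-(α i) / 2)) * ∏ i, (d i) ^ (-(n:ℝ) / 2) := by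
      rw [← Finset.prod_mul_distrib]
      refine Finset.prod_congr rfl fun i _ => ?_
      rw [← Real.rpow_add (hd i)]
      congr 1; ring
    rw [hg, hp, Matrix.mul_add, Matrix.trace_add, mul_add, Real.exp_add]
    ring
  · simp only [if_neg hd, mul_zero, zero_mul]

/-- Fully Bayesian marginal joint posterior with unknown `σ²`: under the hierarchical model
of Lemma 1 but with `σ² ~ InverseGamma(a₀, b₀)` (density `∝ (σ²)^{−a₀−1} exp(−b₀/σ²)`),
integrating out `β_γ`, `(L,D)` and `σ²` yields
`π(γ, 𝒟 | Y, X) ∝ π(γ|𝒟) π(𝒟) · [z_𝒟(U+XᵀX, n+α)/z_𝒟(U, α)] ·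
det(I + τ² X_γᵀ X_γ)^{−1/2} · {b₀ + ½ Yᵀ(Iₙ + τ² X_γ X_γᵀ)⁻¹ Y}^{−(n+2a₀)/2}`,
with a proportionality constant depending only on the data `(Y, X)`. -/
theorem joint_posterior_form_unknown_variance {n p : ℕ} (hn : 0 < n)
    (X : Matrix (Fin n) (Fin p) ℝ) (Y : Fin n → ℝ)
    (τ a b q a₀ b₀ : ℝ) (hτ : 0 < τ) (ha : 0 < a) (hb : 0 ≤ b)
    (hq : 0 < q) (hq1 : q < 1) (ha₀ : 0 < a₀) (hb₀ : 0 < b₀) (R : ℕ) (hR : 0 < R)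
    (U : Matrix (Fin p) (Fin p) ℝ) (hU : U.PosDef)
    (α : (Fin p → Finset (Fin p)) → Fin p → ℝ)
    (hα : ∀ pa, ∀ i : Fin p, 2 < α pa i - ((pa i).card : ℝ)) :
    ∃ c : ℝ, 0 < c ∧
      ∀ (γ : Fin p → Bool) (pa : Fin p → Finset (Fin p)),
        (∀ i : Fin p, ∀ j ∈ pa i, i < j) →
        mrfPrior a b R pa γ * dagPrior q R pa
            * (∫ l : ∀ i : Fin p, {j // j ∈ pa i} → ℝ, ∫ d : Fin p → ℝ,
                dagWishartDensity pa U (α pa) d l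
                  * ∏ k : Fin n,
                      gaussDensity
                        (cholFactor pa l * (Matrix.diagonal d)⁻¹
                          * (cholFactor pa l).transpose) (X k))
            * (∫ s in Set.Ioi (0 : ℝ),
                (b₀ ^ a₀ / Real.Gamma a₀ * s ^ (-a₀ - 1) * Real.exp (-b₀ / s))
                  * ∫ β : {i // γ i = true} → ℝ,
                      ((2 * π * s) ^ (-(n : ℝ) / 2)
                          * Real.exp (-((Y - designSub X γ *ᵥ β)
                              ⬝ᵥ (Y - designSub X γ *ᵥ β)) / (2 * s)))
                        * ((2 * π * τ ^ 2 * s) ^ (-((Finset.univ.filter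
                              (fun i => γ i = true)).card : ℝ) / 2)
                          * Real.exp (-(β ⬝ᵥ β) / (2 * τ ^ 2 * s))))
          = c * (mrfPrior a b R pa γ * dagPrior q R pa
              * (zDAG pa (U + X.transpose * X) (fun i => (n : ℝ) + α pa i)
                  / zDAG pa U (α pa))
              * Matrix.det (1 + (τ ^ 2) • ((designSub X γ).transpose * designSub X γ))
                  ^ (-(1 : ℝ) / 2)
              * (b₀ + (1 / 2) * (Y ⬝ᵥ
                  ((1 + (τ ^ 2) • (designSub X γ * (designSub X γ).transpose))⁻¹ *ᵥ Y)))
                  ^ (-((n : ℝ) + 2 * a₀) / 2)) := by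
  refine ⟨((2 * π) ^ (-(p : ℝ) / 2)) ^ n * (b₀ ^ a₀ / Real.Gamma a₀ * (2 * π) ^ (-(n : ℝ) / 2)
          * Real.Gamma (a₀ + (n : ℝ) / 2)), ?_, ?_⟩
  · have h1 := Real.Gamma_pos_of_pos ha₀
    have h2 : 0 < Real.Gamma (a₀ + (n : ℝ) / 2) := Real.Gamma_pos_of_pos (by positivity)
    positivity
  · intro γ pa hpa
    have hc : (Finset.univ.filter (fun i => γ i = true)).card = Fintype.card {i // γ i = true} :=
      (Fintype.card_subtype _).symm
    have h2 := quad_gamma (designSub X γ) Y τ a₀ b₀ hτ ha₀ hb₀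
    rw [Fintype.card_fin] at h2
    rw [wishart_part X U hU pa hpa (α pa) (hα pa), hc, h2]
    ring

end
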